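/- Fix y = (y₁,y₂,y₃) ∈ ℝ³ with y₃ > 0 and f ∈ ℝ³. Define uᴬᵢ(x) = Σⱼ Sᵢⱼ(x,y) fⱼ, uᴮᵢ(x) = Σⱼ Sᵢⱼ(x,yᴵ) fᴵⱼ, the harmonic potential φ(x) = fᴵ₃ Gˢ(x,yᴵ) + y₃ Gᴰ[fᴵ](x,yᴵ), the Papkovich–Neuber correction uᶜᵢ(x) = x₃ ∂φ/∂xᵢ(x) − δᵢ₃ φ(x), and uᵂᵢ(x) = uᴬᵢ(x) − uᴮᵢ(x) − uᶜᵢ(x). Then uᵂ satisfies the no-slip condition: uᵂᵢ(x) = 0 for all i = 1,2,3 and every x = (x₁,x₂,0) with x ≠ yᴵ. -/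

import Mathlib

open Real Finset

noncomputable section

/-- Points in three-dimensional Euclidean space. -/
abbrev E3 := EuclideanSpace ℝ (Fin 3)

/-- Partial derivative `∂f/∂xᵢ` of a scalar field on `ℝ³`. -/
def pd (i : Fin 3) (f : E3 → ℝ) (x : E3) : ℝ :=
  fderiv ℝ f x (EuclideanSpace.single i 1)

/-- Kronecker delta. -/
def kron (i j : Fin 3) : ℝ := if i = j then 1 else 0

/-- Reflected image point `yᴵ = (y₁, y₂, -y₃)`. -/
def reflPt (y : E3) : E3 := (EuclideanSpace.equiv (Fin 3) ℝ).symm ![y 0, y 1, -y 2]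

/-- Reflected vector `fᴵ = (f₁, f₂, -f₃)`. -/
def reflVec (f : Fin 3 → ℝ) : Fin 3 → ℝ := ![f 0, f 1, -f 2]

/-- Harmonic potential of a unit charge, `Gˢ(x,y) = 1/(4π|x-y|)`. -/
def GS (x y : E3) : ℝ := 1 / (4 * π * ‖x - y‖)

/-- Harmonic potential of a unit dipole with orientation `ν`:
`Gᴰ[ν](x,y) = Σᵢ νᵢ ∂/∂yᵢ Gˢ(x,y)`. -/
def GD (ν : Fin 3 → ℝ) (x y : E3) : ℝ := ∑ i, ν i * pd i (fun z => GS x z) y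

/-- Harmonic potential of a unit quadrupole with orientations `ν, κ`:
`G^Q[ν,κ](x,y) = Σᵢ Σⱼ νᵢ κⱼ ∂²/∂yᵢ∂yⱼ Gˢ(x,y)`. -/
def GQ (ν κ : Fin 3 → ℝ) (x y : E3) : ℝ :=
  ∑ i, ∑ j, ν i * κ j * pd i (fun z => pd j (fun w => GS x w) z) y

/-- The Stokeslet (single layer kernel)
`Sᵢⱼ(x,y) = (1/8π)[δᵢⱼ/|x-y| + (xᵢ-yᵢ)(xⱼ-yⱼ)/|x-y|³]`. -/
def stokeslet (x y : E3) (i j : Fin 3) : ℝ :=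
  (1 / (8 * π)) * (kron i j / ‖x - y‖ + (x i - y i) * (x j - y j) / ‖x - y‖ ^ 3)

/-- The Papkovich–Neuber potential for the Stokeslet image system:
`φ(x) = fᴵ₃ Gˢ(x,yᴵ) + y₃ Gᴰ[fᴵ](x,yᴵ)`. -/
def phiS (y : E3) (f : Fin 3 → ℝ) (x : E3) : ℝ :=
  reflVec f 2 * GS x (reflPt y) + y 2 * GD (reflVec f) x (reflPt y)

/-- The half-space Stokeslet velocity
`uᵂᵢ(x) = Σⱼ Sᵢⱼ(x,y) fⱼ - Σⱼ Sᵢⱼ(x,yᴵ) fᴵⱼ - [x₃ ∂φ/∂xᵢ(x) - δᵢ₃ φ(x)]`. -/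
def uW (y : E3) (f : Fin 3 → ℝ) (i : Fin 3) (x : E3) : ℝ :=
  (∑ j, stokeslet x y i j * f j) - (∑ j, stokeslet x (reflPt y) i j * reflVec f j)
    - (x 2 * pd i (phiS y f) x - if i = 2 then phiS y f x else 0)

/-- The gradient of the unit charge potential with respect to its source point. -/
theorem pd_GS {x y : E3} (hxy : x ≠ y) (i : Fin 3) :
    pd i (fun z => GS x z) y = (x i - y i) / (4 * π * ‖x - y‖ ^ 3) := by
  have hr : ‖x - y‖ ≠ 0 := norm_ne_zero_iff.2 (sub_ne_zero.2 hxy)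
  have hsq := ((hasFDerivAt_id (𝕜 := ℝ) y).const_sub x).norm_sq
  have hnorm := hsq.sqrt (by simpa using hr)
  simp only [id, Real.sqrt_sq (norm_nonneg _)] at hnorm
  have hGS := (hasDerivAt_inv (by positivity)).comp_hasFDerivAt y (hnorm.const_mul (4 * π))
  have hfun : (fun z => GS x z) = Inv.inv ∘ fun z => 4 * π * ‖x - z‖ := by
    funext z
    simp [GS]
  rw [pd, hfun, hGS.fderiv]
  simp [EuclideanSpace.inner_single_right]
  field_simp
  ring

/-- Closed form of the unit dipole potential. -/
theorem GD_eq {x y : E3} (hxy : x ≠ y) (ν : Fin 3 → ℝ) :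
    GD ν x y = (∑ i, ν i * (x i - y i)) / (4 * π * ‖x - y‖ ^ 3) := by
  simp only [GD, pd_GS hxy, Finset.sum_div, mul_div_assoc]

/-- Points of the plane `x₃ = 0` are equidistant from a point and its image. -/
theorem norm_sub_reflPt {x : E3} (hx : x 2 = 0) (y : E3) : ‖x - reflPt y‖ = ‖x - y‖ := by
  simp [EuclideanSpace.norm_eq, Fin.sum_univ_three, reflPt, hx]

/-- the half-space Stokeslet `uᵂ = uᴬ - uᴮ - uᶜ` satisfies the
no-slip condition on the plane `x₃ = 0`. -/
theorem stokeslet_halfspace_no_slip (y : E3) (hy : 0 < y 2) (f : Fin 3 → ℝ) :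
    ∀ x : E3, x 2 = 0 → x ≠ reflPt y → ∀ i, uW y f i x = 0 := by
  intro x hx hxy i
  have hr : ‖x - y‖ ≠ 0 := by
    rw [← norm_sub_reflPt hx]
    exact norm_ne_zero_iff.2 (sub_ne_zero.2 hxy)
  simp only [uW, phiS, stokeslet, GS, GD_eq hxy, norm_sub_reflPt hx, hx, zero_mul]
  fin_cases i <;> simp [Fin.sum_univ_three, kron, reflVec, reflPt, hx] <;> field_simp <;> ring
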